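/- Main convergence theorem for the incremental subgradient method with line search: Let H be a real Hilbert space, C ⊂ H nonempty closed convex, f_1,…,f_K : H → [0,∞) convex continuous with bounded subgradients on C (‖g‖ ≤ M_i for g ∈ ∂f_i(x), x ∈ C), and argmin_{x∈C} ∑_i f_i ≠ ∅. Let step-ranges satisfy ∑ λ̄_n = ∞, ∑ λ̄_n² < ∞, λ̲_n/λ̄_n → 1, ∑(λ̄_n − λ̲_n) < ∞. Define x_1 ∈ C and, for each n, y_{n,0} := x_n, y_{n,i} := P_C(y_{n,i−1} − λ_{n,i} g_{n,i}) with g_{n,i} ∈ ∂f_{n,i}(y_{n,i−1}) and arbitrary λ_{n,i} ∈ [λ̲_n, λ̄_n], and x_{n+1} := y_{n,K}. Then {x_n} converges weakly to an optimal solution of min_{x∈C} ∑_i f_i(x). -/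

import Mathlib

open Filter Topology Finset InnerProductSpace

/-- Weak convergence of a sequence in a real inner product space. -/
def WeakConv {H : Type*} [NormedAddCommGroup H] [InnerProductSpace ℝ H]
    (x : ℕ → H) (p : H) : Prop :=
  ∀ y : H, Tendsto (fun n => ⟪x n, y⟫_ℝ) atTop (𝓝 ⟪p, y⟫_ℝ)

/-- `g` is a subgradient of `f` at `x`. -/
def IsSubgrad {H : Type*} [NormedAddCommGroup H] [InnerProductSpace ℝ H]
    (f : H → ℝ) (x g : H) : Prop :=
  ∀ z : H, f x + ⟪z - x, g⟫_ℝ ≤ f z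

section AuxiliaryLemmas

/-- A nonnegative sequence that decreases up to a summable error converges, and the decrements
are summable. -/
lemma quasi_monotone_convergence {a b e : ℕ → ℝ} (ha : ∀ n, 0 ≤ a n) (hb : ∀ n, 0 ≤ b n)
    (he : Summable e) (h : ∀ n, a (n + 1) + b n ≤ a n + e n) :
    Summable b ∧ ∃ l, Tendsto a atTop (𝓝 l) := by
  obtain ⟨B, hB⟩ := he.hasSum.tendsto_sum_nat.bddAbove_range
  have hB' : ∀ n, ∑ k ∈ range n, e k ≤ B := fun n => hB ⟨n, rfl⟩
  have hsum : ∀ n, a n + ∑ k ∈ range n, b k ≤ a 0 + ∑ k ∈ range n, e k := by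
    intro n
    induction n with
    | zero => simp
    | succ n ih =>
      rw [sum_range_succ, sum_range_succ]
      linarith [h n]
  refine ⟨summable_of_sum_range_le (c := a 0 + B) hb fun n => ?_, ?_⟩
  · linarith [hsum n, ha n, hB' n]
  · have hanti : Antitone fun n => a n - ∑ k ∈ range n, e k := by
      refine antitone_nat_of_succ_le fun n => ?_
      rw [sum_range_succ]
      linarith [h n, hb n]
    have hbdd : BddBelow (Set.range fun n => a n - ∑ k ∈ range n, e k) := by
      refine ⟨-B, ?_⟩
      rintro _ ⟨n, rfl⟩
      have h1 := ha n
      have h2 := hB' n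
      simp only
      linarith
    refine ⟨_, ((tendsto_atTop_ciInf hanti hbdd).add he.hasSum.tendsto_sum_nat).congr ?_⟩
    intro n
    ring

/-- If `∑ α n = ∞`, `∑ α n ^ 2 < ∞`, `∑ α n * β n < ∞` and `β` increases by at most `θ * α n` at
step `n`, then `β` tends to zero. -/
lemma tendsto_zero_of_summable_mul {α β : ℕ → ℝ} {θ : ℝ} (hα : ∀ n, 0 ≤ α n)
    (hβ : ∀ n, 0 ≤ β n) (hdiv : ¬ Summable α) (hsq : Summable fun n => α n ^ 2)
    (hmul : Summable fun n => α n * β n) (hstep : ∀ n, β (n + 1) ≤ β n + θ * α n) :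
    Tendsto β atTop (𝓝 0) := by
  have hsqstep : ∀ n, β (n + 1) ^ 2 + 0 ≤
      β n ^ 2 + (2 * θ * (α n * β n) + θ ^ 2 * α n ^ 2) := by
    intro n
    have := pow_le_pow_left₀ (hβ (n + 1)) (hstep n) 2
    nlinarith
  obtain ⟨-, l, hl⟩ := quasi_monotone_convergence (a := fun n => β n ^ 2) (b := fun _ => 0)
    (fun n => sq_nonneg _) (fun _ => le_rfl) ((hmul.mul_left _).add (hsq.mul_left _)) hsqstep
  have hroot : Tendsto β atTop (𝓝 (√l)) :=
    hl.sqrt.congr fun n => Real.sqrt_sq (hβ n)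
  rcases (Real.sqrt_nonneg l).eq_or_lt with h0 | hpos
  · rwa [← h0] at hroot
  · refine absurd ?_ hdiv
    refine (hmul.mul_left (2 / √l)).of_norm_bounded_eventually_nat ?_
    filter_upwards [hroot.eventually (lt_mem_nhds (half_lt_self hpos))] with n hn
    rw [Real.norm_of_nonneg (hα n), div_mul_eq_mul_div, le_div_iff₀ hpos]
    nlinarith [hα n]

variable {H : Type*} [NormedAddCommGroup H] [InnerProductSpace ℝ H]

/-- A continuous convex function on a Hilbert space has a subgradient at every point. -/
lemma exists_isSubgrad [CompleteSpace H] {f : H → ℝ} (hf : ConvexOn ℝ Set.univ f)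
    (hc : Continuous f) (x : H) : ∃ g, IsSubgrad f x g := by
  have hopen : IsOpen {p : H × ℝ | p.1 ∈ Set.univ ∧ f p.1 < p.2} := by
    simpa using isOpen_lt (hc.comp continuous_fst) continuous_snd
  obtain ⟨φ, hφ⟩ := geometric_hahn_banach_point_open (x := (x, f x)) hf.convex_strict_epigraph
    hopen (by simp)
  have hsplit : ∀ z t, φ (z, t) = φ (z, 0) + t * φ (0, 1) := by
    intro z t
    rw [← smul_eq_mul, ← map_smul, ← map_add]
    simp
  have hpos : 0 < φ (0, 1) := by
    have := hφ (x, f x + 1) (by simp)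
    rw [hsplit, hsplit x (f x + 1)] at this
    linarith
  set c := φ (0, 1)
  let ψ : StrongDual ℝ H := φ.comp (ContinuousLinearMap.inl ℝ H ℝ)
  have hψ : ∀ z, ψ z = φ (z, 0) := fun z => rfl
  refine ⟨-(c⁻¹ • (toDual ℝ H).symm ψ), fun z => ?_⟩
  rw [real_inner_comm, inner_neg_left, real_inner_smul_left, toDual_symm_apply, map_sub, hψ, hψ]
  refine le_of_forall_pos_le_add fun ε hε => ?_
  have := hφ (z, f z + ε) (by simpa using hε)
  rw [hsplit, hsplit z (f z + ε)] at this
  have key : c * (f x + -(c⁻¹ * (φ (z, 0) - φ (x, 0)))) ≤ c * (f z + ε) := by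
    have : c * (f x + -(c⁻¹ * (φ (z, 0) - φ (x, 0)))) =
        c * f x - (φ (z, 0) - φ (x, 0)) := by
      field_simp
      ring
    rw [this]
    linarith
  exact le_of_mul_le_mul_left key hpos

/-- Bounded subgradients yield a Lipschitz-type bound. -/
lemma sub_le_of_subgrad_bound [CompleteSpace H] {f : H → ℝ} (hf : ConvexOn ℝ Set.univ f)
    (hc : Continuous f) {C : Set H} {M : ℝ} (hM : ∀ x ∈ C, ∀ g, IsSubgrad f x g → ‖g‖ ≤ M)
    {x : H} (hx : x ∈ C) (y : H) : f x - f y ≤ M * ‖y - x‖ := by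
  obtain ⟨g, hg⟩ := exists_isSubgrad hf hc x
  have h1 := hg y
  have h2 := neg_le_of_abs_le (abs_real_inner_le_norm (y - x) g)
  have h3 := mul_le_mul_of_nonneg_left (hM x hx g hg) (norm_nonneg (y - x))
  linarith

/-- Variational characterization of nearest points of a convex set. -/
lemma inner_sub_nearest_le_zero {C : Set H} (hC : Convex ℝ C) {u p z : H} (hp : p ∈ C)
    (hmin : ∀ w ∈ C, ‖u - p‖ ≤ ‖u - w‖) (hz : z ∈ C) : ⟪u - p, z - p⟫_ℝ ≤ 0 := by
  refine (norm_eq_iInf_iff_real_inner_le_zero hC hp).1 ?_ z hz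
  have : Nonempty C := ⟨⟨p, hp⟩⟩
  refine le_antisymm (le_ciInf fun w => hmin w w.2) ?_
  exact ciInf_le (f := fun w : C => ‖u - w‖) ⟨0, by rintro _ ⟨w, rfl⟩; exact norm_nonneg _⟩ ⟨p, hp⟩

lemma norm_nearest_sub_sq_le {C : Set H} (hC : Convex ℝ C) {u p z : H} (hp : p ∈ C)
    (hmin : ∀ w ∈ C, ‖u - p‖ ≤ ‖u - w‖) (hz : z ∈ C) : ‖p - z‖ ^ 2 ≤ ‖u - z‖ ^ 2 := by
  have h1 := inner_sub_nearest_le_zero hC hp hmin hz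
  have h2 := norm_sub_sq_real (u - p) (z - p)
  rw [sub_sub_sub_cancel_right] at h2
  rw [norm_sub_rev p z]
  nlinarith [sq_nonneg ‖u - p‖]

/-- One projected subgradient step. -/
lemma projected_subgradient_step {C : Set H} (hC : Convex ℝ C) {f : H → ℝ} {y g p z : H}
    {t M : ℝ} (ht : 0 ≤ t) (hg : IsSubgrad f y g) (hM : ‖g‖ ≤ M) (hp : p ∈ C)
    (hmin : ∀ w ∈ C, ‖y - t • g - p‖ ≤ ‖y - t • g - w‖) (hz : z ∈ C) :
    ‖p - z‖ ^ 2 ≤ ‖y - z‖ ^ 2 - 2 * t * (f y - f z) + t ^ 2 * M ^ 2 := by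
  have h1 := norm_nearest_sub_sq_le hC hp hmin hz
  have h2 : ‖y - t • g - z‖ ^ 2 = ‖y - z‖ ^ 2 - 2 * (t * ⟪y - z, g⟫_ℝ) + t ^ 2 * ‖g‖ ^ 2 := by
    rw [sub_right_comm, norm_sub_sq_real, real_inner_smul_right, norm_smul, mul_pow,
      Real.norm_eq_abs, sq_abs]
  have h3 := hg z
  rw [← neg_sub y z, inner_neg_left] at h3
  have h4 : t * (f y - f z) ≤ t * ⟪y - z, g⟫_ℝ := mul_le_mul_of_nonneg_left (by linarith) ht
  have h5 : t ^ 2 * ‖g‖ ^ 2 ≤ t ^ 2 * M ^ 2 := by gcongr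
  linarith

/-- A bounded sequence in a Hilbert space converges weakly along every ultrafilter. -/
lemma exists_weak_limit_ultrafilter [CompleteSpace H] {x : ℕ → H} {R : ℝ}
    (hx : ∀ n, ‖x n‖ ≤ R) (U : Ultrafilter ℕ) :
    ∃ u : H, ∀ y, Tendsto (fun n => ⟪x n, y⟫_ℝ) U (𝓝 ⟪u, y⟫_ℝ) := by
  have hlim : ∀ y, ∃ l, Tendsto (fun n => ⟪x n, y⟫_ℝ) U (𝓝 l) ∧ |l| ≤ R * ‖y‖ := by
    intro y
    have hmem : ∀ n, ⟪x n, y⟫_ℝ ∈ Set.Icc (-(R * ‖y‖)) (R * ‖y‖) := fun n =>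
      abs_le.1 ((abs_real_inner_le_norm _ _).trans (by gcongr; exact hx n))
    obtain ⟨l, hl, hle⟩ := isCompact_Icc.ultrafilter_le_nhds
      (U.map fun n => ⟪x n, y⟫_ℝ) (le_principal_iff.2 (Ultrafilter.mem_map.2 (univ_mem' hmem)))
    exact ⟨l, hle, abs_le.2 hl⟩
  choose L hL hLb using hlim
  let φ : H →ₗ[ℝ] ℝ :=
    { toFun := L
      map_add' := fun y z => tendsto_nhds_unique (hL (y + z)) <| by
        simpa only [inner_add_right] using (hL y).add (hL z)
      map_smul' := fun c y => tendsto_nhds_unique (hL (c • y)) <| by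
        simpa only [real_inner_smul_right, RingHom.id_apply, smul_eq_mul] using (hL y).const_mul c }
  refine ⟨(toDual ℝ H).symm (φ.mkContinuous R hLb), fun y => ?_⟩
  rw [toDual_symm_apply]
  exact hL y

/-- Opial-type criterion for weak convergence: the distances to each point of `S` converge, and
all weak limits along ultrafilters lie in `S`. -/
lemma exists_weakConv_of_opial [CompleteSpace H] {S : Set H} (hS : S.Nonempty) {x : ℕ → H}
    (hdist : ∀ z ∈ S, ∃ l, Tendsto (fun n => ‖x n - z‖ ^ 2) atTop (𝓝 l))
    (hlim : ∀ (U : Ultrafilter ℕ), ↑U ≤ (atTop : Filter ℕ) → ∀ u : H,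
      (∀ y, Tendsto (fun n => ⟪x n, y⟫_ℝ) U (𝓝 ⟪u, y⟫_ℝ)) → u ∈ S) :
    ∃ u ∈ S, WeakConv x u := by
  obtain ⟨z, hz⟩ := hS
  obtain ⟨l, hl⟩ := hdist z hz
  obtain ⟨B, hB⟩ := hl.bddAbove_range
  have hbound : ∀ n, ‖x n‖ ≤ √B + ‖z‖ := fun n => by
    have h1 : ‖x n - z‖ ≤ √B := Real.le_sqrt_of_sq_le (hB ⟨n, rfl⟩)
    linarith [norm_sub_norm_le (x n) z]
  have hex := exists_weak_limit_ultrafilter hbound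
  obtain ⟨u, hu⟩ := hex (Ultrafilter.of atTop)
  have huS := hlim _ (Ultrafilter.of_le _) u hu
  refine ⟨u, huS, fun y => ?_⟩
  rw [tendsto_iff_ultrafilter]
  intro U hU
  obtain ⟨v, hv⟩ := hex U
  have hvS := hlim U hU v hv
  suffices h : u = v by rw [h]; exact hv y
  obtain ⟨a, ha⟩ := hdist u huS
  obtain ⟨b, hb⟩ := hdist v hvS
  have hconv : Tendsto (fun n => ⟪x n, u - v⟫_ℝ) atTop
      (𝓝 ((b - a + (‖u‖ ^ 2 - ‖v‖ ^ 2)) / 2)) := by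
    refine (((hb.sub ha).add_const (‖u‖ ^ 2 - ‖v‖ ^ 2)).div_const 2).congr fun n => ?_
    rw [norm_sub_sq_real, norm_sub_sq_real, inner_sub_right]
    ring
  have h1 := tendsto_nhds_unique (hu (u - v)) (hconv.mono_left (Ultrafilter.of_le _))
  have h2 := tendsto_nhds_unique (hv (u - v)) (hconv.mono_left hU)
  have h3 : ⟪u - v, u - v⟫_ℝ = 0 := by rw [inner_sub_left, h1, h2, sub_self]
  exact sub_eq_zero.1 (inner_self_eq_zero.1 h3)

end AuxiliaryLemmas

theorem incremental_subgradient_method_weak_convergence {H : Type*} [NormedAddCommGroup H]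
    [InnerProductSpace ℝ H] [CompleteSpace H]
    (C : Set H) (hCne : C.Nonempty) (hCcl : IsClosed C) (hCcv : Convex ℝ C)
    (P : H → H) (hP : ∀ u : H, P u ∈ C ∧ ∀ z ∈ C, ‖u - P u‖ ≤ ‖u - z‖)
    (K : ℕ) (hK : 0 < K)
    (f : ℕ → H → ℝ) (hfnn : ∀ i x, 0 ≤ f i x)
    (hfconv : ∀ i, ConvexOn ℝ Set.univ (f i)) (hfcont : ∀ i, Continuous (f i))
    (Mi : ℕ → ℝ) (hMi : ∀ i, 0 < Mi i)
    (hbdd : ∀ i, 1 ≤ i → i ≤ K → ∀ x ∈ C, ∀ g : H, IsSubgrad (f i) x g → ‖g‖ ≤ Mi i)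
    (hargmin : ∃ yhat ∈ C, ∀ z ∈ C,
      ∑ i ∈ Finset.Icc 1 K, f i yhat ≤ ∑ i ∈ Finset.Icc 1 K, f i z)
    (lo hi : ℕ → ℝ) (hlo : ∀ n, 0 < lo n) (hlohi : ∀ n, lo n ≤ hi n)
    (hdiv : ¬ Summable hi) (hsq : Summable (fun n => hi n ^ 2))
    (hratio : Tendsto (fun n => lo n / hi n) atTop (𝓝 1))
    (hgap : Summable (fun n => hi n - lo n))
    (lam : ℕ → ℕ → ℝ) (hlam : ∀ n i, 1 ≤ i → i ≤ K → lam n i ∈ Set.Icc (lo n) (hi n))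
    (g : ℕ → ℕ → H) (x : ℕ → H) (y : ℕ → ℕ → H)
    (hx0 : x 0 ∈ C)
    (hy0 : ∀ n, y n 0 = x n)
    (hrec : ∀ n, ∀ i, 1 ≤ i → i ≤ K →
      IsSubgrad (f i) (y n (i - 1)) (g n i) ∧ y n i = P (y n (i - 1) - lam n i • g n i))
    (hxn : ∀ n, x (n + 1) = y n K) :
    ∃ u : H, u ∈ C ∧
      (∀ z ∈ C, ∑ i ∈ Finset.Icc 1 K, f i u ≤ ∑ i ∈ Finset.Icc 1 K, f i z) ∧
      WeakConv x u := by
  set F : H → ℝ := fun z => ∑ i ∈ Finset.Icc 1 K, f i z with hF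
  set M : ℝ := ∑ i ∈ Finset.Icc 1 K, Mi i with hM
  have hM0 : 0 ≤ M := sum_nonneg fun i _ => (hMi i).le
  have hhi0 : ∀ n, 0 ≤ hi n := fun n => (hlo n).le.trans (hlohi n)
  have hxC : ∀ n, x n ∈ C := by
    intro n
    cases n with
    | zero => exact hx0
    | succ n =>
      rw [hxn, (hrec n K hK le_rfl).2]
      exact (hP _).1
  have hyC : ∀ n i, i ≤ K → y n i ∈ C := by
    intro n i hiK
    cases i with
    | zero => rw [hy0]; exact hxC n
    | succ i =>
      rw [(hrec n (i + 1) (by omega) hiK).2]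
      exact (hP _).1
  have hgM : ∀ n i, i + 1 ≤ K → ‖g n (i + 1)‖ ≤ Mi (i + 1) := fun n i hiK =>
    hbdd (i + 1) (by omega) hiK _ (hyC n i (by omega)) _ (hrec n (i + 1) (by omega) hiK).1
  have hstep : ∀ n i, i + 1 ≤ K → ‖y n (i + 1) - y n i‖ ≤ hi n * Mi (i + 1) := by
    intro n i hiK
    obtain ⟨-, hyi⟩ := hrec n (i + 1) (by omega) hiK
    obtain ⟨hl1, hl2⟩ := hlam n (i + 1) (by omega) hiK
    rw [Nat.add_sub_cancel] at hyi
    obtain ⟨hp, hmin⟩ := hP (y n i - lam n (i + 1) • g n (i + 1))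
    rw [← hyi] at hp hmin
    have h := norm_nearest_sub_sq_le hCcv hp hmin (hyC n i (by omega))
    have hl0 : 0 ≤ lam n (i + 1) := (hlo n).le.trans hl1
    rw [sub_right_comm, sub_self, zero_sub, norm_neg, norm_smul, Real.norm_of_nonneg hl0] at h
    refine (le_of_sq_le_sq h (by positivity)).trans ?_
    exact mul_le_mul hl2 (hgM n i hiK) (norm_nonneg _) (hhi0 n)
  have hdrift : ∀ n i, i ≤ K → ‖y n i - x n‖ ≤ hi n * M := by
    intro n i hiK
    have h : ‖y n i - x n‖ ≤ hi n * ∑ j ∈ Finset.Icc 1 i, Mi j := by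
      induction i with
      | zero => simp [hy0]
      | succ i ih =>
        rw [sum_Icc_succ_top (by omega), mul_add]
        have := norm_sub_le_norm_sub_add_norm_sub (y n (i + 1)) (y n i) (x n)
        linarith [ih (by omega), hstep n i hiK]
    refine h.trans (mul_le_mul_of_nonneg_left ?_ (hhi0 n))
    exact sum_le_sum_of_subset_of_nonneg (Icc_subset_Icc_right hiK) fun j _ _ => (hMi j).le
  have hlip : ∀ i, 1 ≤ i → i ≤ K → ∀ u ∈ C, ∀ v, f i u - f i v ≤ Mi i * ‖v - u‖ :=
    fun i h1 h2 u hu v => sub_le_of_subgrad_bound (hfconv i) (hfcont i) (hbdd i h1 h2) hu v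
  set A : ℝ := ∑ i ∈ Finset.Icc 1 K, (Mi i ^ 2 + 2 * (Mi i * M))
  have hmain : ∀ z ∈ C, ∀ n, ‖x (n + 1) - z‖ ^ 2 + 2 * lo n * (F (x n) - F z) ≤
      ‖x n - z‖ ^ 2 + (hi n ^ 2 * A + 2 * (hi n - lo n) * F z) := by
    intro z hz n
    have h : ∀ k, k ≤ K → ‖y n k - z‖ ^ 2 ≤ ‖x n - z‖ ^ 2 +
        ∑ i ∈ Finset.Icc 1 k, (hi n ^ 2 * (Mi i ^ 2 + 2 * (Mi i * M)) +
          2 * (hi n - lo n) * f i z - 2 * lo n * (f i (x n) - f i z)) := by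
      intro k hkK
      induction k with
      | zero => simp [hy0]
      | succ k ih =>
        rw [sum_Icc_succ_top (by omega)]
        have ih := ih (by omega)
        obtain ⟨hsub, hyk⟩ := hrec n (k + 1) (by omega) hkK
        obtain ⟨hl1, hl2⟩ := hlam n (k + 1) (by omega) hkK
        rw [Nat.add_sub_cancel] at hyk hsub
        obtain ⟨hp, hmin⟩ := hP (y n k - lam n (k + 1) • g n (k + 1))
        rw [← hyk] at hp hmin
        have hl0 : 0 ≤ lam n (k + 1) := (hlo n).le.trans hl1
        have hs := projected_subgradient_step hCcv hl0 hsub (hgM n k hkK) hp hmin hz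
        have hL := hlip (k + 1) (by omega) hkK (x n) (hxC n) (y n k)
        have hD := mul_le_mul_of_nonneg_left (hdrift n k (by omega)) (hMi (k + 1)).le
        have e1 : lam n (k + 1) ^ 2 * Mi (k + 1) ^ 2 ≤ hi n ^ 2 * Mi (k + 1) ^ 2 := by gcongr
        have e2 := mul_le_mul_of_nonneg_right hl1 (hfnn (k + 1) (y n k))
        have e3 := mul_le_mul_of_nonneg_right hl2 (hfnn (k + 1) z)
        have e4 : lo n * (f (k + 1) (x n) - f (k + 1) (y n k)) ≤
            hi n * (Mi (k + 1) * (hi n * M)) :=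
          (mul_le_mul_of_nonneg_left (hL.trans hD) (hlo n).le).trans
            (mul_le_mul_of_nonneg_right (hlohi n)
              (mul_nonneg (hMi _).le (mul_nonneg (hhi0 n) hM0)))
        linarith
    have h := h K le_rfl
    rw [← hxn, sum_sub_distrib, sum_add_distrib, ← mul_sum, ← mul_sum, ← mul_sum,
      sum_sub_distrib] at h
    linarith
  have herr : ∀ z, Summable fun n => hi n ^ 2 * A + 2 * (hi n - lo n) * F z := fun z =>
    (hsq.mul_right A).add ((hgap.mul_left 2).mul_right (F z))
  have hfejer : ∀ z ∈ C, (∀ w ∈ C, F z ≤ F w) →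
      (Summable fun n => 2 * lo n * (F (x n) - F z)) ∧
        ∃ l, Tendsto (fun n => ‖x n - z‖ ^ 2) atTop (𝓝 l) := fun z hz hzmin =>
    quasi_monotone_convergence (fun n => sq_nonneg _)
      (fun n => mul_nonneg (by linarith [hlo n]) (sub_nonneg.2 (hzmin _ (hxC n))))
      (herr z) (hmain z hz)
  obtain ⟨yhat, hyhC, hyhmin⟩ := hargmin
  have hvalue : Tendsto (fun n => F (x n) - F yhat) atTop (𝓝 0) := by
    have hβ : ∀ n, 0 ≤ F (x n) - F yhat := fun n => sub_nonneg.2 (hyhmin _ (hxC n))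
    refine tendsto_zero_of_summable_mul (θ := M * M) hhi0 hβ hdiv hsq ?_ fun n => ?_
    · refine (hfejer yhat hyhC hyhmin).1.of_norm_bounded_eventually_nat ?_
      filter_upwards [hratio.eventually (lt_mem_nhds (by norm_num : (1 / 2 : ℝ) < 1))] with n hn
      rw [Real.norm_of_nonneg (mul_nonneg (hhi0 n) (hβ n))]
      rw [lt_div_iff₀ ((hlo n).trans_le (hlohi n))] at hn
      exact mul_le_mul_of_nonneg_right (by linarith) (hβ n)
    · have h1 : F (x (n + 1)) - F (x n) ≤ M * ‖x n - x (n + 1)‖ := by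
        rw [hF, hM, ← sum_sub_distrib, sum_mul]
        refine sum_le_sum fun i hi => ?_
        rw [Finset.mem_Icc] at hi
        exact hlip i hi.1 hi.2 _ (hxC _) _
      have h2 := hdrift n K le_rfl
      rw [← hxn, norm_sub_rev] at h2
      have h3 := mul_le_mul_of_nonneg_left h2 hM0
      linarith
  have hFconv : ConvexOn ℝ Set.univ F := by
    refine ⟨convex_univ, fun u _ v _ a b ha hb hab => ?_⟩
    simp only [hF, smul_sum]
    rw [← sum_add_distrib]
    exact sum_le_sum fun i _ => (hfconv i).2 trivial trivial ha hb hab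
  have hFcont : Continuous F := continuous_finsetSum _ fun i _ => hfcont i
  obtain ⟨u, ⟨huC, humin⟩, hu⟩ := exists_weakConv_of_opial
    (S := {z | z ∈ C ∧ ∀ w ∈ C, F z ≤ F w}) ⟨yhat, hyhC, hyhmin⟩ (x := x)
    (fun z hz => (hfejer z hz.1 hz.2).2) (by
      intro U hU u hu
      have hdiff : ∀ w v, Tendsto (fun n => ⟪x n - w, v⟫_ℝ) U (𝓝 ⟪u - w, v⟫_ℝ) := fun w v => by
        simpa only [inner_sub_left] using (hu v).sub_const _
      refine ⟨?_, fun w hw => ?_⟩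
      · obtain ⟨hp, hmin⟩ := hP u
        have h : ⟪u - P u, u - P u⟫_ℝ ≤ 0 := le_of_tendsto' (hdiff (P u) (u - P u)) fun n => by
          rw [real_inner_comm]
          exact inner_sub_nearest_le_zero hCcv hp hmin (hxC n)
        rw [sub_eq_zero.1 (inner_self_eq_zero.1 (h.antisymm real_inner_self_nonneg))]
        exact hp
      · obtain ⟨s, hs⟩ := exists_isSubgrad hFconv hFcont u
        have h1 := (hdiff u s).const_add (F u)
        rw [sub_self, inner_zero_left, add_zero] at h1
        have h2 : Tendsto (fun n => F (x n)) U (𝓝 (F yhat)) := by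
          simpa using (hvalue.mono_left hU).add_const (F yhat)
        exact (le_of_tendsto_of_tendsto' h1 h2 fun n => hs (x n)).trans (hyhmin w hw))
  exact ⟨u, huC, humin, hu⟩
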